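/- arXiv:1908.01415 — 3 statements merged into one kernel-verified Lean document; each statement's English description precedes it below -/
import Mathlib

section
/- Let G be a finite simple bipartite graph on the vertex set {1,…,d}. Then the edge polytope P(G) = conv{ e_i + e_j ∈ ℝ^d : {i,j} is an edge of G } has the integer decomposition property: for every positive integer k and every lattice point α ∈ kP(G) ∩ ℤ^d there exist α_1,…,α_k ∈ P(G) ∩ ℤ^d with α = α_1 + ⋯ + α_k. -/
open scoped Pointwise

/-- A point of `ℝ^ι` is a lattice point if all its coordinates are integers. -/
def IsLatticePoint {ι : Type*} (x : ι → ℝ) : Prop := ∀ i, ∃ z : ℤ, x i = (z : ℝ)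

/-- A set `P ⊆ ℝ^ι` has the integer decomposition property if every lattice
point of the `k`-th dilate `kP` is the sum of `k` lattice points of `P`. -/
def HasIDP {ι : Type*} [Fintype ι] (P : Set (ι → ℝ)) : Prop :=
  ∀ k : ℕ, 0 < k → ∀ α : ι → ℝ, IsLatticePoint α → α ∈ (k : ℝ) • P →
    ∃ f : Fin k → (ι → ℝ), (∀ j, f j ∈ P ∧ IsLatticePoint (f j)) ∧ (∑ j, f j) = α

/-- The edge polytope `P(G) = conv{e_i + e_j : {i,j} ∈ E(G)}` of a graph `G`
on the vertex set `{1, …, d}`. -/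
noncomputable def edgePolytope (d : ℕ) (G : SimpleGraph (Fin d)) : Set (Fin d → ℝ) :=
  convexHull ℝ {x | ∃ i j, G.Adj i j ∧ x = Pi.single i 1 + Pi.single j 1}

/-- A linear inequality valid on the generators is valid on the dilated polytope. -/
lemma edgePolytope_ineq (d : ℕ) (G : SimpleGraph (Fin d)) (c : Fin d → ℝ) (r : ℝ)
    (hc : ∀ i j, G.Adj i j → r ≤ c i + c j) (k : ℕ) (α : Fin d → ℝ)
    (hα : α ∈ (k : ℝ) • edgePolytope d G) : k * r ≤ ∑ i, c i * α i := by
  obtain ⟨x, hx, rfl⟩ := hα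
  have h1 : r ≤ ∑ i, c i * x i := by
    have hlin : IsLinearMap ℝ (fun y : Fin d → ℝ => ∑ i, c i * y i) := by
      constructor
      · intro y z
        simp [mul_add, Finset.sum_add_distrib]
      · intro a y
        simp only [Pi.smul_apply, smul_eq_mul, Finset.mul_sum]
        exact Finset.sum_congr rfl fun i _ => by ring
    have hsub : edgePolytope d G ⊆ {y : Fin d → ℝ | r ≤ ∑ i, c i * y i} := by
      refine convexHull_min ?_ (convex_halfSpace_ge hlin r)
      rintro y ⟨i, j, hij, rfl⟩
      simpa [mul_add, Finset.sum_add_distrib, Pi.single_apply] using hc i j hij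
    exact hsub hx
  have h2 : ∑ i, c i * ((k : ℝ) • x) i = k * ∑ i, c i * x i := by
    simp only [Pi.smul_apply, smul_eq_mul, Finset.mul_sum]
    exact Finset.sum_congr rfl fun i _ => by ring
  simp only [h2]
  exact mul_le_mul_of_nonneg_left h1 (Nat.cast_nonneg k)

lemma sum_slots_single (d : ℕ) (n : Fin d → ℕ) :
    ∑ l : (Σ i, Fin (n i)), (Pi.single l.1 1 : Fin d → ℝ) = fun v => (n v : ℝ) := by
  funext v
  rw [Fintype.sum_sigma]
  simp [Finset.sum_apply, Pi.single_apply]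

/-- The edge polytope of a bipartite graph has the integer decomposition property. -/
theorem edgePolytope_bipartite_hasIDP (d : ℕ) (G : SimpleGraph (Fin d))
    (hbip : ∃ A : Set (Fin d), ∀ ⦃i j : Fin d⦄, G.Adj i j →
      (i ∈ A ∧ j ∉ A) ∨ (i ∉ A ∧ j ∈ A)) :
    HasIDP (edgePolytope d G) := by
  classical
  obtain ⟨A, hA⟩ := hbip
  intro k _ α hlat hα
  have key := fun c r hc => edgePolytope_ineq d G c r hc k α hα
  have hnn : ∀ i, 0 ≤ α i := by
    intro v
    have := key (Pi.single v 1) 0 (by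
      intro i j _
      simp only [Pi.single_apply]
      split_ifs <;> norm_num)
    simpa [Pi.single_apply] using this
  have hn : ∀ i, ∃ n : ℕ, α i = n := by
    intro i
    obtain ⟨z, hz⟩ := hlat i
    have h0 : (0 : ℤ) ≤ z := by
      have := hnn i
      rw [hz] at this
      exact_mod_cast this
    lift z to ℕ using h0
    exact ⟨z, by simpa using hz⟩
  choose n hn using hn
  let nA : Fin d → ℕ := fun i => if i ∈ A then n i else 0
  let nB : Fin d → ℕ := fun i => if i ∈ A then 0 else n i
  have sumEq : ∀ (c : Fin d → ℝ) (r : ℝ), (∀ i j, G.Adj i j → c i + c j = r) →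
      ∑ i, c i * α i = k * r := by
    intro c r hc
    apply le_antisymm
    · have := key (fun i => - c i) (-r) (fun i j h => by have := hc i j h; linarith)
      simp only [neg_mul, Finset.sum_neg_distrib, mul_neg] at this
      linarith
    · exact key c r (fun i j h => (hc i j h).ge)
  have cardA : ∑ i, nA i = k := by
    have := sumEq (fun i => if i ∈ A then 1 else 0) 1 (by
      intro i j h
      rcases hA h with ⟨h1, h2⟩ | ⟨h1, h2⟩ <;> simp [h1, h2])
    have h2 : ((∑ i, nA i : ℕ) : ℝ) = k := by
      rw [← mul_one (k : ℝ), ← this]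
      push_cast
      refine Finset.sum_congr rfl fun i _ => ?_
      by_cases h : i ∈ A <;> simp [nA, h, hn]
    exact_mod_cast h2
  have cardB : ∑ i, nB i = k := by
    have := sumEq (fun i => if i ∈ A then 0 else 1) 1 (by
      intro i j h
      rcases hA h with ⟨h1, h2⟩ | ⟨h1, h2⟩ <;> simp [h1, h2])
    have h2 : ((∑ i, nB i : ℕ) : ℝ) = k := by
      rw [← mul_one (k : ℝ), ← this]
      push_cast
      refine Finset.sum_congr rfl fun i _ => ?_
      by_cases h : i ∈ A <;> simp [nB, h, hn]
    exact_mod_cast h2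
  -- Hall's condition at the level of vertices
  have hall : ∀ I : Finset (Fin d),
      ∑ i ∈ I, nA i ≤ ∑ j ∈ Finset.univ.filter (fun j => ∃ i ∈ I, G.Adj i j), nB j := by
    intro I
    have := key (fun v => (if v ∈ A then 0 else if ∃ i ∈ I, G.Adj i v then 1 else 0)
        - (if v ∈ A then if v ∈ I then 1 else 0 else 0)) 0 (by
      intro i j h
      rcases hA h with ⟨h1, h2⟩ | ⟨h1, h2⟩
      · simp only [h1, h2, if_true, if_false]
        by_cases hi : i ∈ I
        · have : ∃ i ∈ I, G.Adj i j := ⟨i, hi, h⟩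
          simp [hi, this]
        · simp only [hi, if_false]
          split_ifs <;> norm_num
      · simp only [h1, h2, if_true, if_false]
        by_cases hi : j ∈ I
        · have : ∃ j ∈ I, G.Adj j i := ⟨j, hi, h.symm⟩
          simp [hi, this]
        · simp only [hi, if_false]
          split_ifs <;> norm_num)
    simp only [sub_mul, Finset.sum_sub_distrib, mul_zero] at this
    have e1 : ((∑ i ∈ I, nA i : ℕ) : ℝ)
        = ∑ v, (if v ∈ A then if v ∈ I then (1 : ℝ) else 0 else 0) * α v := by
      rw [← Finset.filter_univ_mem I, Finset.sum_filter]
      push_cast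
      refine Finset.sum_congr rfl fun v _ => ?_
      by_cases h : v ∈ A <;> by_cases h' : v ∈ I <;> simp [nA, h, h', hn]
    have e2 : ((∑ j ∈ Finset.univ.filter (fun j => ∃ i ∈ I, G.Adj i j), nB j : ℕ) : ℝ)
        = ∑ v, (if v ∈ A then 0 else if ∃ i ∈ I, G.Adj i v then (1 : ℝ) else 0) * α v := by
      rw [Finset.sum_filter]
      push_cast
      refine Finset.sum_congr rfl fun v _ => ?_
      by_cases h : v ∈ A <;> by_cases h' : ∃ i ∈ I, G.Adj i v <;>
        simp only [nB, h, h', hn, if_true, if_false] <;> simp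
    have : ((∑ i ∈ I, nA i : ℕ) : ℝ) ≤
      ((∑ j ∈ Finset.univ.filter (fun j => ∃ i ∈ I, G.Adj i j), nB j : ℕ) : ℝ) := by
      rw [e1, e2]; linarith
    exact_mod_cast this
  obtain ⟨m, hm, hadj⟩ := (Fintype.all_card_le_filter_rel_iff_exists_injective
    (fun (a : Σ i, Fin (nA i)) (b : Σ i, Fin (nB i)) => G.Adj a.1 b.1)).1 (by
      intro S
      have s1 : S ⊆ (S.image Sigma.fst).sigma fun _ => Finset.univ := by
        intro a ha
        simp only [Finset.mem_sigma, Finset.mem_univ, and_true]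
        exact Finset.mem_image_of_mem _ ha
      have s2 : ((Finset.univ.filter
          (fun j => ∃ i ∈ S.image Sigma.fst, G.Adj i j)).sigma fun _ => Finset.univ) ⊆
          Finset.univ.filter (fun b : (Σ i, Fin (nB i)) => ∃ a ∈ S, G.Adj a.1 b.1) := by
        intro b hb
        simp only [Finset.mem_sigma, Finset.mem_univ, and_true, Finset.mem_filter, true_and] at hb ⊢
        obtain ⟨i, hi, hij⟩ := hb
        obtain ⟨a, ha, rfl⟩ := Finset.mem_image.1 hi
        exact ⟨a, ha, hij⟩
      have c1 := Finset.card_le_card s1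
      have c2 := Finset.card_le_card s2
      simp only [Finset.card_sigma, Finset.card_univ, Fintype.card_fin] at c1 c2
      exact c1.trans ((hall _).trans c2))
  have hbij : Function.Bijective m := by
    rw [Fintype.bijective_iff_injective_and_card]
    exact ⟨hm, by simp [cardA, cardB]⟩
  have e : Fin k ≃ (Σ i, Fin (nA i)) :=
    Fintype.equivOfCardEq (by simp [cardA])
  refine ⟨fun t => Pi.single (e t).1 1 + Pi.single (m (e t)).1 1, fun t => ⟨?_, ?_⟩, ?_⟩
  · exact subset_convexHull ℝ _ ⟨_, _, hadj _, rfl⟩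
  · intro i
    refine ⟨(Pi.single (e t).1 1 + Pi.single (m (e t)).1 1 : Fin d → ℤ) i, ?_⟩
    simp [Pi.single_apply]
  · refine (Equiv.sum_comp e
      (fun l => (Pi.single l.1 1 + Pi.single (m l).1 1 : Fin d → ℝ))).trans ?_
    rw [Finset.sum_add_distrib,
      hbij.sum_comp (fun b : (Σ i, Fin (nB i)) => (Pi.single b.1 1 : Fin d → ℝ)),
      sum_slots_single, sum_slots_single]
    funext v
    by_cases h : v ∈ A <;> simp [nA, nB, h, hn]
end

section
/- Let P_1,…,P_m ⊂ ℝ^n be lattice polytopes and let Q = conv( (P_1 × {e_1}) ∪ ⋯ ∪ (P_m × {e_m}) ) ⊂ ℝ^{n+m} be their Cayley sum, where e_1,…,e_m are the standard unit vectors of ℝ^m. If Q has the integer decomposition property, then for all nonnegative integers a_1,…,a_m the Minkowski sum a_1P_1 + ⋯ + a_mP_m has the integer decomposition property. -/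
open scoped Pointwise

/-- A lattice polytope: the convex hull of a nonempty finite set of lattice points. -/
def IsLatticePolytope {ι : Type*} (P : Set (ι → ℝ)) : Prop :=
  ∃ V : Finset (ι → ℝ), V.Nonempty ∧ (∀ v ∈ V, IsLatticePoint v) ∧
    P = convexHull ℝ (V : Set (ι → ℝ))

/-- The Cayley sum `conv((P_1 × {e_1}) ∪ ⋯ ∪ (P_m × {e_m})) ⊆ ℝ^{n+m}`
of the polytopes `P_1, …, P_m ⊆ ℝ^n`; the ambient space `ℝ^{n+m}` is realized
as `(Fin n ⊕ Fin m) → ℝ` and `P_i × {e_i}` is the image of `P_i` under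
appending the `i`-th standard unit vector of `ℝ^m`. -/
noncomputable def cayleySum (n m : ℕ) (P : Fin m → Set (Fin n → ℝ)) :
    Set ((Fin n ⊕ Fin m) → ℝ) :=
  convexHull ℝ (⋃ i : Fin m, (fun x => Sum.elim x (Pi.single i 1)) '' P i)

lemma cayley_aux (n m : ℕ) (P : Fin m → Set (Fin n → ℝ)) (hc : ∀ i, Convex ℝ (P i))
    (y : (Fin n ⊕ Fin m) → ℝ) (hy : y ∈ cayleySum n m P) :
    (∀ i, 0 ≤ y (Sum.inr i)) ∧ (∑ i, y (Sum.inr i) = 1) ∧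
      ∀ i, y (Sum.inr i) = 1 → (fun l => y (Sum.inl l)) ∈ P i := by
  have key : cayleySum n m P ⊆ {y | (∀ i, 0 ≤ y (Sum.inr i)) ∧ (∑ i, y (Sum.inr i) = 1) ∧
      ∀ i, y (Sum.inr i) = 1 → (fun l => y (Sum.inl l)) ∈ P i} := by
    apply convexHull_min
    · intro z hz
      simp only [Set.mem_iUnion, Set.mem_image] at hz
      obtain ⟨i, x, hx, rfl⟩ := hz
      refine ⟨fun j => ?_, ?_, fun j hj => ?_⟩
      · simp only [Sum.elim_inr, Pi.single_apply]; split_ifs <;> norm_num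
      · simp
      · by_cases h : j = i
        · subst h; simpa using hx
        · simp [Pi.single_apply, h] at hj
    · rw [convex_iff_forall_pos]
      rintro u ⟨hu0, hu1, hu2⟩ v ⟨hv0, hv1, hv2⟩ p q hp hq hpq
      have le1 : ∀ (w : (Fin n ⊕ Fin m) → ℝ), (∀ i, 0 ≤ w (Sum.inr i)) →
          (∑ i, w (Sum.inr i) = 1) → ∀ i, w (Sum.inr i) ≤ 1 := by
        intro w h0 h1 i
        rw [← h1]
        exact Finset.single_le_sum (f := fun i => w (Sum.inr i)) (fun j _ => h0 j)
          (Finset.mem_univ i)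
      refine ⟨fun j => ?_, ?_, fun j hj => ?_⟩
      · have := hu0 j
        have := hv0 j
        simp only [Pi.add_apply, Pi.smul_apply, smul_eq_mul]
        positivity
      · simp only [Pi.add_apply, Pi.smul_apply, smul_eq_mul, Finset.sum_add_distrib,
          ← Finset.mul_sum, hu1, hv1]
        linarith
      · simp only [Pi.add_apply, Pi.smul_apply, smul_eq_mul] at hj
        have h1 := le1 u hu0 hu1 j
        have h2 := le1 v hv0 hv1 j
        have e1 : u (Sum.inr j) = 1 := by
          by_contra h
          have : u (Sum.inr j) < 1 := lt_of_le_of_ne h1 h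
          nlinarith
        have e2 : v (Sum.inr j) = 1 := by
          by_contra h
          have : v (Sum.inr j) < 1 := lt_of_le_of_ne h2 h
          nlinarith
        exact hc j (hu2 j e1) (hv2 j e2) hp.le hq.le hpq
  exact key hy

lemma lattice_aux (n m : ℕ) (P : Fin m → Set (Fin n → ℝ)) (hc : ∀ i, Convex ℝ (P i))
    (y : (Fin n ⊕ Fin m) → ℝ) (hy : y ∈ cayleySum n m P) (hl : IsLatticePoint y) :
    ∃ i, (fun l => y (Sum.inl l)) ∈ P i ∧ ∀ j, y (Sum.inr j) = if i = j then 1 else 0 := by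
  obtain ⟨h0, h1, h2⟩ := cayley_aux n m P hc y hy
  have : ∃ i, y (Sum.inr i) ≠ 0 := by
    by_contra! h
    simp [h] at h1
  obtain ⟨i, hi⟩ := this
  have hi1 : 1 ≤ y (Sum.inr i) := by
    obtain ⟨z, hz⟩ := hl (Sum.inr i)
    have := h0 i
    rw [hz] at this hi ⊢
    have a1 : 0 ≤ z := by exact_mod_cast this
    have a2 : z ≠ 0 := by exact_mod_cast hi
    have : 1 ≤ z := by omega
    exact_mod_cast this
  have hs := Finset.add_sum_erase Finset.univ (fun i => y (Sum.inr i)) (Finset.mem_univ i)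
  simp only [h1] at hs
  have hnn : 0 ≤ ∑ x ∈ Finset.univ.erase i, y (Sum.inr x) := Finset.sum_nonneg fun j _ => h0 j
  have hz : ∑ x ∈ Finset.univ.erase i, y (Sum.inr x) = 0 := by linarith
  have hi2 : y (Sum.inr i) = 1 := by linarith
  refine ⟨i, h2 i hi2, fun j => ?_⟩
  split_ifs with h
  · rw [← h, hi2]
  · exact (Finset.sum_eq_zero_iff_of_nonneg fun j _ => h0 j).1 hz j
      (Finset.mem_erase.2 ⟨fun e => h e.symm, Finset.mem_univ j⟩)

lemma sum_mem_smul_aux {n : ℕ} {S : Set (Fin n → ℝ)} (hc : Convex ℝ S) (hne : S.Nonempty)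
    (N : ℕ) (x : Fin N → Fin n → ℝ) (hx : ∀ s, x s ∈ S) : ∑ s, x s ∈ (N : ℝ) • S := by
  rcases Nat.eq_zero_or_pos N with rfl | hN
  · obtain ⟨p, hp⟩ := hne
    exact ⟨p, hp, by simp⟩
  · have hN' : (N : ℝ) ≠ 0 := by positivity
    refine ⟨∑ s, (N : ℝ)⁻¹ • x s, ?_, ?_⟩
    · apply hc.sum_mem
      · intros; positivity
      · simp [hN']
      · intro s _; exact hx s
    · simp [← Finset.smul_sum, smul_smul, hN']

lemma lattice_sum {κ ι : Type*} (s : Finset κ) (f : κ → ι → ℝ)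
    (h : ∀ j ∈ s, IsLatticePoint (f j)) : IsLatticePoint (∑ j ∈ s, f j) := by
  classical
  intro i
  rw [Finset.sum_apply]
  induction s using Finset.induction_on with
  | empty => exact ⟨0, by simp⟩
  | insert a s ha ih =>
    obtain ⟨z, hz⟩ := ih fun j hj => h j (Finset.mem_insert_of_mem hj)
    obtain ⟨w, hw⟩ := h a (Finset.mem_insert_self a s) i
    exact ⟨w + z, by rw [Finset.sum_insert ha, hz, hw]; push_cast; rfl⟩

/-- If the Cayley sum of lattice polytopes `P_1, …, P_m` has the integer
decomposition property, then so does every Minkowski sum `a_1 P_1 + ⋯ + a_m P_m`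
with nonnegative integer coefficients. -/
theorem cayleySum_IDP_imp_minkowskiSum_IDP (n m : ℕ)
    (P : Fin m → Set (Fin n → ℝ)) (hP : ∀ i, IsLatticePolytope (P i))
    (hQ : HasIDP (cayleySum n m P)) (a : Fin m → ℕ) :
    HasIDP (∑ i : Fin m, (a i : ℝ) • P i) := by
  classical
  have hc : ∀ i, Convex ℝ (P i) := by
    intro i
    obtain ⟨V, -, -, h⟩ := hP i
    rw [h]; exact convex_convexHull _ _
  have hne : ∀ i, (P i).Nonempty := by
    intro i
    obtain ⟨V, hV, -, h⟩ := hP i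
    rw [h]; exact hV.to_set.convexHull
  intro k hk α hα hmem
  obtain ⟨β, hβ, hβα⟩ := hmem
  rw [Set.mem_finset_sum] at hβ
  obtain ⟨g, hg, hgβ⟩ := hβ
  choose p hp hpg using fun i => hg (i := i) (Finset.mem_univ i)
  simp only at hpg hβα
  -- decomposition in the Cayley cone
  have main : ∃ f : Fin (k * ∑ i, a i) → (Fin n ⊕ Fin m → ℝ),
      (∀ j, f j ∈ cayleySum n m P ∧ IsLatticePoint (f j)) ∧
      ∑ j, f j = Sum.elim α (fun i => ((k * a i : ℕ) : ℝ)) := by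
    have hrep : (Sum.elim α (fun i => ((k * a i : ℕ) : ℝ)) : Fin n ⊕ Fin m → ℝ) =
        ∑ i, ((k * a i : ℕ) : ℝ) • (Sum.elim (p i) (Pi.single i 1) : Fin n ⊕ Fin m → ℝ) := by
      ext (l | i)
      · rw [← hβα, ← hgβ]
        simp [← hpg, Finset.mul_sum, mul_assoc]
      · simp [Pi.single_apply]
    rcases Nat.eq_zero_or_pos (k * ∑ i, a i) with h0 | hpos
    · have ha : ∀ i, a i = 0 := by
        have : ∑ i, a i = 0 := by
          rcases Nat.mul_eq_zero.1 h0 with h | h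
          · omega
          · exact h
        simpa using this
      have : IsEmpty (Fin (k * ∑ i, a i)) := by rw [h0]; infer_instance
      refine ⟨fun j => isEmptyElim j, fun j => isEmptyElim j, ?_⟩
      rw [hrep]
      simp [ha]
    · refine hQ _ hpos _ ?_ ?_
      · rintro (l | i)
        · exact hα l
        · exact ⟨(k * a i : ℕ), by simp⟩
      · have hN' : ((k * ∑ i, a i : ℕ) : ℝ) ≠ 0 := by positivity
        refine ⟨∑ i, (((k * ∑ i, a i : ℕ) : ℝ)⁻¹ * ((k * a i : ℕ) : ℝ)) •
          (Sum.elim (p i) (Pi.single i 1) : Fin n ⊕ Fin m → ℝ), ?_, ?_⟩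
        · apply (convex_convexHull ℝ _).sum_mem
          · intros; positivity
          · rw [← Finset.mul_sum, ← Nat.cast_sum, ← Finset.mul_sum]
            exact inv_mul_cancel₀ hN'
          · intro i _
            apply subset_convexHull
            exact Set.mem_iUnion.2 ⟨i, p i, hp i, rfl⟩
        · rw [hrep]
          simp only [mul_smul, ← Finset.smul_sum]
          rw [smul_inv_smul₀ hN']
  obtain ⟨f, hf, hfs⟩ := main
  choose c hcP hcr using fun j => lattice_aux n m P hc (f j) (hf j).1 (hf j).2
  have hcard : ∀ i, Fintype.card {j // c j = i} = Fintype.card (Fin k × Fin (a i)) := by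
    intro i
    have h := congrFun hfs (Sum.inr i)
    simp only [Finset.sum_apply, hcr, Sum.elim_inr, Finset.sum_boole] at h
    rw [Fintype.card_subtype, Fintype.card_prod, Fintype.card_fin, Fintype.card_fin]
    exact_mod_cast h
  let e : ∀ i, (Fin k × Fin (a i)) ≃ {j // c j = i} := fun i => (Fintype.equivOfCardEq (hcard i)).symm
  let x : Fin (k * ∑ i, a i) → Fin n → ℝ := fun j l => f j (Sum.inl l)
  have hxl : ∀ j, IsLatticePoint (x j) := fun j l => (hf j).2 (Sum.inl l)
  refine ⟨fun t => ∑ i, ∑ s, x (e i (t, s)).1, fun t => ⟨?_, ?_⟩, ?_⟩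
  · rw [Set.mem_finset_sum]
    refine ⟨fun i => ∑ s, x (e i (t, s)).1, fun {i} _ => ?_, rfl⟩
    apply sum_mem_smul_aux (hc i) (hne i)
    intro s
    have := hcP (e i (t, s)).1
    rw [(e i (t, s)).2] at this
    exact this
  · exact lattice_sum _ _ fun i _ => lattice_sum _ _ fun s _ => hxl _
  · rw [Finset.sum_comm]
    have h1 : ∀ i, ∑ t, ∑ s, x (e i (t, s)).1 = ∑ j : {j // c j = i}, x j.1 := by
      intro i
      rw [← Fintype.sum_prod_type' (f := fun t s => x (e i (t, s)).1)]
      exact Equiv.sum_comp (e i) (fun j => x j.1)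
    simp only [h1]
    rw [Fintype.sum_fiberwise c x]
    ext l
    have h := congrFun hfs (Sum.inl l)
    simpa [x] using h
end

section
/- Let S_1,…,S_m be nonempty subsets of {1,…,n}. Then the set of lattice points of the Minkowski sum Δ_{S_1} + ⋯ + Δ_{S_m} ⊂ ℝ^n equals the Minkowski sum of the sets of lattice points of the summands: (Δ_{S_1} ∩ ℤ^n) + ⋯ + (Δ_{S_m} ∩ ℤ^n) = (Δ_{S_1} + ⋯ + Δ_{S_m}) ∩ ℤ^n. -/
open scoped Pointwise

/-- The unit simplex `Δ_S ⊆ ℝ^n`: the convex hull of the standard unit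
vectors `e_i` for `i ∈ S`. -/
noncomputable def unitSimplex (n : ℕ) (S : Finset (Fin n)) : Set (Fin n → ℝ) :=
  convexHull ℝ {x | ∃ i ∈ S, x = Pi.single i 1}

lemma unitSimplex_props {n : ℕ} {S : Finset (Fin n)} {x : Fin n → ℝ}
    (hx : x ∈ unitSimplex n S) :
    (∀ i, 0 ≤ x i) ∧ (∑ i, x i = 1) ∧ (∀ i, i ∉ S → x i = 0) := by
  have hc : Convex ℝ {x : Fin n → ℝ |
      (∀ i, 0 ≤ x i) ∧ (∑ i, x i = 1) ∧ (∀ i, i ∉ S → x i = 0)} := by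
    rintro x ⟨hx0, hx1, hx2⟩ y ⟨hy0, hy1, hy2⟩ a b ha hb hab
    refine ⟨fun i => ?_, ?_, fun i hi => ?_⟩
    · have := mul_nonneg ha (hx0 i)
      have := mul_nonneg hb (hy0 i)
      simp only [Pi.add_apply, Pi.smul_apply, smul_eq_mul]
      linarith
    · simp only [Pi.add_apply, Pi.smul_apply, smul_eq_mul, Finset.sum_add_distrib,
        ← Finset.mul_sum, hx1, hy1]
      linarith
    · simp [hx2 i hi, hy2 i hi]
  refine convexHull_min ?_ hc hx
  rintro _ ⟨i, hi, rfl⟩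
  refine ⟨fun j => ?_, ?_, fun j hj => ?_⟩
  · by_cases h : j = i
    · subst h; simp
    · simp [h]
  · simp
  · have : j ≠ i := by rintro rfl; exact hj hi
    simp [this]

lemma exists_choice {n m : ℕ} (S : Fin m → Finset (Fin n)) (f : Fin m → Fin n → ℝ)
    (h0 : ∀ k i, 0 ≤ f k i) (h1 : ∀ k, ∑ i, f k i = 1) (h2 : ∀ k i, i ∉ S k → f k i = 0)
    (c : Fin n → ℕ) (hc : ∀ i, ∑ k, f k i = c i) :
    ∃ p : Fin m → Fin n, (∀ k, p k ∈ S k) ∧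
      ∀ i, (∑ k, (Pi.single (p k) (1 : ℝ) : Fin n → ℝ) i) = c i := by
  classical
  let t : Fin m → Finset (Σ i : Fin n, Fin (c i)) := fun k => (S k).sigma fun _ => Finset.univ
  have hall : ∀ s : Finset (Fin m), s.card ≤ (s.biUnion t).card := by
    intro s
    have e : s.biUnion t = (s.biUnion S).sigma fun _ => Finset.univ := by
      ext a; simp [t]
    rw [e, Finset.card_sigma]
    simp only [Finset.card_univ, Fintype.card_fin]
    have : (s.card : ℝ) ≤ ((∑ i ∈ s.biUnion S, c i : ℕ) : ℝ) := by
      push_cast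
      calc (s.card : ℝ) = ∑ k ∈ s, ∑ i, f k i := by simp [h1]
        _ = ∑ k ∈ s, ∑ i ∈ s.biUnion S, f k i := by
          refine Finset.sum_congr rfl fun k hk => ?_
          symm
          refine Finset.sum_subset (Finset.subset_univ _) fun i _ hi => h2 k i fun h => hi ?_
          exact Finset.mem_biUnion.2 ⟨k, hk, h⟩
        _ = ∑ i ∈ s.biUnion S, ∑ k ∈ s, f k i := Finset.sum_comm
        _ ≤ ∑ i ∈ s.biUnion S, (c i : ℝ) := by
          refine Finset.sum_le_sum fun i _ => ?_
          rw [← hc]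
          exact Finset.sum_le_sum_of_subset_of_nonneg (Finset.subset_univ _) fun k _ _ => h0 k i
    exact_mod_cast this
  obtain ⟨g, hg, hgt⟩ := (Finset.all_card_le_biUnion_card_iff_exists_injective t).1 hall
  have hcard : Fintype.card (Fin m) = Fintype.card (Σ i : Fin n, Fin (c i)) := by
    simp only [Fintype.card_sigma, Fintype.card_fin]
    have : (m : ℝ) = ((∑ i, c i : ℕ) : ℝ) := by
      push_cast
      simp only [← hc]
      rw [Finset.sum_comm]
      simp [h1]
    exact_mod_cast this
  have hb : Function.Bijective g := (Fintype.bijective_iff_injective_and_card g).2 ⟨hg, hcard⟩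
  refine ⟨fun k => (g k).1, fun k => ?_, fun i => ?_⟩
  · have := hgt k
    simp only [t, Finset.mem_sigma] at this
    exact this.1
  · rw [hb.sum_comp (fun a : (Σ i : Fin n, Fin (c i)) => (Pi.single a.1 (1 : ℝ) : Fin n → ℝ) i)]
    rw [Fintype.sum_sigma]
    simp [Pi.single_apply]

/-- The lattice points of the Minkowski sum `Δ_{S_1} + ⋯ + Δ_{S_m}` are exactly
the Minkowski sums of the lattice points of the summands. -/
theorem latticePoints_minkowskiSum_simplices (n m : ℕ)
    (S : Fin m → Finset (Fin n)) (hS : ∀ k, (S k).Nonempty) :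
    (∑ k : Fin m, {x ∈ unitSimplex n (S k) | IsLatticePoint x}) =
      {x ∈ ∑ k : Fin m, unitSimplex n (S k) | IsLatticePoint x} := by
  ext x
  simp only [Set.mem_ofPred_eq, Set.mem_fintype_sum]
  constructor
  · rintro ⟨f, hf, rfl⟩
    refine ⟨⟨f, fun k => (hf k).1, rfl⟩, fun i => ?_⟩
    choose z hz using fun k => (hf k).2 i
    refine ⟨∑ k, z k, ?_⟩
    simp [Finset.sum_apply, hz]
  · rintro ⟨⟨f, hf, rfl⟩, hx⟩
    have hp := fun k => unitSimplex_props (hf k)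
    have hc : ∀ i, ∃ c : ℕ, ∑ k, f k i = c := by
      intro i
      obtain ⟨z, hz⟩ := hx i
      rw [Finset.sum_apply] at hz
      have h0 : 0 ≤ ∑ k, f k i := Finset.sum_nonneg fun k _ => (hp k).1 i
      rw [hz] at h0
      lift z to ℕ using (by exact_mod_cast h0)
      exact ⟨z, by simpa using hz⟩
    choose c hc using hc
    obtain ⟨p, hpS, hpc⟩ := exists_choice S f (fun k => (hp k).1) (fun k => (hp k).2.1)
      (fun k => (hp k).2.2) c hc
    refine ⟨fun k => Pi.single (p k) 1, fun k => ⟨?_, fun i => ?_⟩, ?_⟩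
    · exact subset_convexHull ℝ _ ⟨p k, hpS k, rfl⟩
    · by_cases h : i = p k
      · exact ⟨1, by subst h; simp⟩
      · exact ⟨0, by simp [h]⟩
    · funext i
      rw [Finset.sum_apply, Finset.sum_apply, hpc, hc]
end
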